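/- arXiv:2403.09469 — 2 statements merged into one kernel-verified Lean document; each statement's English description precedes it below -/
import Mathlib

section
/- Let k be a field and let A, B be nilpotent 2×2 matrices over k that commute: A·B = B·A. Then one of them is a scalar multiple of the other, i.e. there exists c ∈ k such that B = c·A or A = c·B. -/
/-- The diagonal relation needs the determinant hypotheses: in characteristic two, commutation
gives only `2 * (a * y) = 2 * (x * b)`. -/
lemma mul_eq_mul_of_sq_eq_neg_mul {k : Type*} [Field k] {a b c x y z : k}
    (hA : a ^ 2 = -(b * c)) (hB : x ^ 2 = -(y * z)) (h : b * z = y * c)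
    (h2 : 2 * (a * y) = 2 * (x * b)) : a * y = x * b := by
  have hsq : (a * y - x * b) ^ 2 = 0 := by
    linear_combination (-y ^ 2) * hA + b ^ 2 * hB - b * y * h + a * y * h2
  exact sub_eq_zero.mp (pow_eq_zero_iff two_ne_zero |>.mp hsq)

lemma Matrix.fin_two_entries_of_isNilpotent {k : Type*} [Field k] {A : Matrix (Fin 2) (Fin 2) k}
    (hA : IsNilpotent A) :
    A 1 1 = -A 0 0 ∧ A 0 0 ^ 2 = -(A 0 1 * A 1 0) := by
  have ht : A.trace = 0 := (Matrix.isNilpotent_trace_of_isNilpotent hA).eq_zero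
  have hd : A.det = 0 := by
    obtain ⟨n, hn⟩ := hA
    have hdet : A.det ^ n = 0 := by
      rw [← Matrix.det_pow, hn, Matrix.det_zero]
    exact eq_zero_of_pow_eq_zero hdet
  rw [Matrix.trace_fin_two] at ht
  rw [Matrix.det_fin_two] at hd
  exact ⟨by linear_combination ht, by linear_combination A 0 0 * ht - hd⟩

/-- Two commuting nilpotent `2 × 2` matrices over a field: one is a scalar multiple of the
other. -/
theorem stmt_4 (k : Type*) [Field k] (A B : Matrix (Fin 2) (Fin 2) k)
    (hA : IsNilpotent A) (hB : IsNilpotent B) (hcomm : A * B = B * A) :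
    ∃ c : k, B = c • A ∨ A = c • B := by
  obtain ⟨hA11, hA2⟩ := Matrix.fin_two_entries_of_isNilpotent hA
  obtain ⟨hB11, hB2⟩ := Matrix.fin_two_entries_of_isNilpotent hB
  have h00 := congr_fun₂ hcomm 0 0
  have h01 := congr_fun₂ hcomm 0 1
  have h10 := congr_fun₂ hcomm 1 0
  simp only [Matrix.mul_apply, Fin.sum_univ_two, hA11, hB11] at h00 h01 h10
  have hoff : A 0 1 * B 1 0 = B 0 1 * A 1 0 := by linear_combination h00
  have hupper : A 0 0 * B 0 1 = B 0 0 * A 0 1 :=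
    mul_eq_mul_of_sq_eq_neg_mul hA2 hB2 hoff (by linear_combination h01)
  have hlower : A 0 0 * B 1 0 = B 0 0 * A 1 0 :=
    mul_eq_mul_of_sq_eq_neg_mul (c := A 0 1) (z := B 0 1)
      (by linear_combination hA2) (by linear_combination hB2)
      (by linear_combination -hoff) (by linear_combination -h10)
  by_cases hb : A 0 1 = 0
  · have ha : A 0 0 = 0 := by simpa [hb] using hA2
    by_cases hc : A 1 0 = 0
    · refine ⟨0, Or.inr ?_⟩
      ext i j
      fin_cases i <;> fin_cases j <;> simp [ha, hb, hc, hA11]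
    · refine ⟨B 1 0 / A 1 0, Or.inl ?_⟩
      ext i j
      fin_cases i <;> fin_cases j <;> simp [hA11, hB11] <;> field_simp <;> grind
  · refine ⟨B 0 1 / A 0 1, Or.inl ?_⟩
    ext i j
    fin_cases i <;> fin_cases j <;> simp [hA11, hB11] <;> field_simp <;> grind
end

section
/- Let k be a field of characteristic p > 0, let a ∈ k be nonzero, and let n be an integer with n > 2, or n = 2 and p = 2. Let A_{a,n} denote k[T]/(T^{p^n}) with the bialgebra structure in which Δ(T̄) = T̄⊗1 + 1⊗T̄ + a·T̄^{p^{n−1}}⊗T̄^{p} and the counit sends T̄ to 0. If φ is a bialgebra automorphism of A_{a,n} and one writes φ(T̄) = Σ_{i=1}^{p^n−1} a_i T̄^i with a_i ∈ k, then a₁^{p^{n−1}+p−1} = 1. -/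
open scoped TensorProduct

/-- `(Δ, ε)` is a bialgebra structure on the `k`-algebra `A`: the comultiplication `Δ` and
counit `ε` are `k`-algebra homomorphisms, `Δ` is coassociative and `ε` is a counit for `Δ`. -/
def IsBialgebraStructure (k A : Type*) [CommRing k] [CommRing A] [Algebra k A]
    (Δ : A →ₐ[k] A ⊗[k] A) (ε : A →ₐ[k] k) : Prop :=
  (∀ x : A, (TensorProduct.assoc k A A A)
      ((TensorProduct.map Δ.toLinearMap (LinearMap.id : A →ₗ[k] A)) (Δ x))
      = (TensorProduct.map (LinearMap.id : A →ₗ[k] A) Δ.toLinearMap) (Δ x)) ∧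
  (∀ x : A, (TensorProduct.lid k A)
      ((TensorProduct.map ε.toLinearMap (LinearMap.id : A →ₗ[k] A)) (Δ x)) = x) ∧
  (∀ x : A, (TensorProduct.rid k A)
      ((TensorProduct.map (LinearMap.id : A →ₗ[k] A) ε.toLinearMap) (Δ x)) = x)

/-- The truncated polynomial ring `k[T]/(T^N)`. -/
abbrev TruncPoly (k : Type*) [CommRing k] (N : ℕ) : Type _ :=
  Polynomial k ⧸ Ideal.span {(Polynomial.X : Polynomial k) ^ N}

/-- The class of `T` in `k[T]/(T^N)`. -/
noncomputable abbrev truncT (k : Type*) [CommRing k] (N : ℕ) : TruncPoly k N :=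
  Ideal.Quotient.mk _ Polynomial.X

open Finset

section Coefficients

variable {k : Type*} [Field k] {N : ℕ}

/-- For `j < N`, the `j`-th coefficient as a linear functional on `k[T]/(T^N)`. -/
theorem TruncPoly.exists_coeff {j : ℕ} (hj : j < N) :
    ∃ c : TruncPoly k N →ₗ[k] k, ∀ i, c (truncT k N ^ i) = if i = j then 1 else 0 := by
  let I : Ideal (Polynomial k) := Ideal.span {(Polynomial.X : Polynomial k) ^ N}
  have hI : I.restrictScalars k ≤ LinearMap.ker (Polynomial.lcoeff k j) := by
    intro f hf
    have hf' : (Polynomial.X : Polynomial k) ^ N ∣ f := Ideal.mem_span_singleton.1 hf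
    exact Polynomial.X_pow_dvd_iff.1 hf' j hj
  refine ⟨(Submodule.liftQ (I.restrictScalars k) (Polynomial.lcoeff k j) hI) ∘ₗ
    (Submodule.Quotient.restrictScalarsEquiv k I).symm.toLinearMap, fun i => ?_⟩
  have : truncT k N ^ i = Submodule.Quotient.mk (p := I) (Polynomial.X ^ i) :=
    (map_pow (Ideal.Quotient.mk I) Polynomial.X i).symm
  rw [this]
  change (Polynomial.X ^ i : Polynomial k).coeff j = _
  simp [Polynomial.coeff_X_pow, eq_comm]

theorem TruncPoly.truncT_pow_self : truncT k N ^ N = 0 := by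
  rw [← map_pow]
  exact Ideal.Quotient.eq_zero_iff_mem.2 (Ideal.mem_span_singleton_self _)

theorem TruncPoly.nontrivial (hN : 0 < N) : Nontrivial (TruncPoly k N) := by
  obtain ⟨c, hc⟩ := TruncPoly.exists_coeff (k := k) hN
  refine ⟨1, 0, fun h => ?_⟩
  have := hc 0
  rw [pow_zero, h] at this
  simp at this

end Coefficients

section Expansion

variable {k A : Type*} [Field k] [CommRing A] [Algebra k A]

/-- The linear functional `x ⊗ y ↦ c x * d y`. -/
noncomputable def tensorFunctional (c d : A →ₗ[k] k) : A ⊗[k] A →ₗ[k] k :=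
  LinearMap.mul' k k ∘ₗ TensorProduct.map c d

@[simp]
theorem tensorFunctional_tmul (c d : A →ₗ[k] k) (x y : A) :
    tensorFunctional c d (x ⊗ₜ[k] y) = c x * d y := by
  simp [tensorFunctional]

theorem tensor_trinomial_pow (t : A) (a : k) (q p i : ℕ) :
    (t ⊗ₜ[k] (1 : A) + (1 : A) ⊗ₜ[k] t + a • ((t ^ q) ⊗ₜ[k] (t ^ p))) ^ i =
      ∑ j ∈ range (i + 1), ∑ l ∈ range (i - j + 1),
        (a ^ j * (i.choose j : k) * ((i - j).choose l : k)) •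
          ((t ^ (l + q * j)) ⊗ₜ[k] (t ^ (i - j - l + p * j))) := by
  rw [add_comm, add_pow]
  refine sum_congr rfl fun j _ => ?_
  rw [add_pow, mul_sum, sum_mul]
  refine sum_congr rfl fun l _ => ?_
  have key : ((t ^ q) ⊗ₜ[k] (t ^ p)) ^ j *
      ((t ⊗ₜ[k] (1 : A)) ^ l * ((1 : A) ⊗ₜ[k] t) ^ (i - j - l)) =
      (t ^ (l + q * j)) ⊗ₜ[k] (t ^ (i - j - l + p * j)) := by
    simp only [Algebra.TensorProduct.tmul_pow, Algebra.TensorProduct.tmul_mul_tmul, one_pow,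
      one_mul, mul_one, ← pow_mul, ← pow_add]
    rw [add_comm l, add_comm (i - j - l)]
  rw [← key, smul_pow]
  simp only [Algebra.smul_def, map_mul, map_natCast, map_pow]
  ring

variable {t : A} {c d : A →ₗ[k] k} {r s : ℕ}

theorem tensorFunctional_trinomial_pow (hc : ∀ i, c (t ^ i) = if i = r then 1 else 0)
    (hd : ∀ i, d (t ^ i) = if i = s then 1 else 0) (a : k) (q p i : ℕ) :
    tensorFunctional c d
        ((t ⊗ₜ[k] (1 : A) + (1 : A) ⊗ₜ[k] t + a • ((t ^ q) ⊗ₜ[k] (t ^ p))) ^ i) =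
      ∑ j ∈ range (i + 1), ∑ l ∈ range (i - j + 1),
        if l + q * j = r ∧ i - j - l + p * j = s then
          a ^ j * (i.choose j : k) * ((i - j).choose l : k) else 0 := by
  simp only [tensor_trinomial_pow, map_sum, map_smul, tensorFunctional_tmul, hc, hd,
    ← ite_and, mul_ite, mul_one, mul_zero, smul_eq_mul]
  refine sum_congr rfl fun j _ => sum_congr rfl fun l _ => ?_
  simp only [and_comm]

theorem tensorFunctional_trinomial_pow_of_lt (hc : ∀ i, c (t ^ i) = if i = r then 1 else 0)
    (hd : ∀ i, d (t ^ i) = if i = s then 1 else 0) (a : k) {q : ℕ} (p : ℕ) (hq : r < q)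
    (i : ℕ) :
    tensorFunctional c d
        ((t ⊗ₜ[k] (1 : A) + (1 : A) ⊗ₜ[k] t + a • ((t ^ q) ⊗ₜ[k] (t ^ p))) ^ i) =
      if i = r + s then (i.choose r : k) else 0 := by
  rw [tensorFunctional_trinomial_pow hc hd, sum_eq_single 0]
  · simp only [mul_zero, add_zero, Nat.sub_zero, pow_zero, Nat.choose_zero_right, Nat.cast_one,
      one_mul]
    split_ifs with h
    · rw [sum_eq_single r]
      · rw [if_pos ⟨rfl, by omega⟩]
      · intro l _ hl
        rw [if_neg (fun h => hl h.1)]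
      · intro hr
        exact absurd (mem_range.2 (by omega)) hr
    · refine sum_eq_zero fun l hl => if_neg ?_
      rw [mem_range] at hl
      omega
  · intro j _ hj
    refine sum_eq_zero fun l _ => if_neg fun h => ?_
    have := Nat.le_mul_of_pos_right q (Nat.pos_of_ne_zero hj)
    omega
  · simp

theorem tensorFunctional_trinomial_pow_self
    (hc : ∀ i, c (t ^ i) = if i = r then 1 else 0)
    (hd : ∀ i, d (t ^ i) = if i = s then 1 else 0) (a : k) (hr : 0 < r) (i : ℕ) :
    tensorFunctional c d
        ((t ⊗ₜ[k] (1 : A) + (1 : A) ⊗ₜ[k] t + a • ((t ^ r) ⊗ₜ[k] (t ^ s))) ^ i) =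
      (if i = r + s then (i.choose r : k) else 0) + if i = 1 then a else 0 := by
  rw [tensorFunctional_trinomial_pow hc hd, sum_range_succ', add_comm]
  congr 1
  · simp only [mul_zero, add_zero, Nat.sub_zero, pow_zero, Nat.choose_zero_right, Nat.cast_one,
      one_mul]
    split_ifs with h
    · rw [sum_eq_single r]
      · rw [if_pos ⟨rfl, by omega⟩]
      · intro l _ hl
        rw [if_neg (fun h => hl h.1)]
      · intro hr
        exact absurd (mem_range.2 (by omega)) hr
    · refine sum_eq_zero fun l hl => if_neg ?_
      rw [mem_range] at hl
      omega
  · split_ifs with h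
    · subst h
      simp
    · refine sum_eq_zero fun j hj => sum_eq_zero fun l hl => if_neg fun ⟨h₁, h₂⟩ => ?_
      rw [mem_range] at hj hl
      rcases Nat.eq_zero_or_pos j with rfl | hj0
      · simp only [zero_add, mul_one] at h₁ h₂ hl
        omega
      · have := Nat.mul_le_mul_left r (show 2 ≤ j + 1 by omega)
        omega

theorem coeff_sum_pow_prime_pow {p : ℕ} [Fact p.Prime] [CharP A p]
    (hc : ∀ i, c (t ^ i) = if i = r then 1 else 0) (S : Finset ℕ) (f : ℕ → k) (e : ℕ) :
    c ((∑ i ∈ S, f i • t ^ i) ^ p ^ e) =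
      ∑ i ∈ S, if i * p ^ e = r then f i ^ p ^ e else 0 := by
  rw [sum_pow_char_pow]
  simp [smul_pow, ← pow_mul, hc]

theorem map_sum_smul_pow {A B : Type*} [Semiring A] [Algebra k A] [Semiring B] [Algebra k B]
    (ψ : A →ₐ[k] B) (t : A) (S : Finset ℕ) (f : ℕ → k) : ψ (∑ i ∈ S, f i • t ^ i) = ∑ i ∈ S, f i • ψ t ^ i := by
  simp

theorem sq_dvd_sum_smul_pow (t : A) {f : ℕ → k} (h : f 1 = 0) {M : ℕ} :
    t ^ 2 ∣ ∑ i ∈ Icc 1 M, f i • t ^ i := by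
  refine dvd_sum fun i hi => ?_
  rw [mem_Icc] at hi
  rcases eq_or_lt_of_le hi.1 with rfl | hi
  · simp [h]
  · rw [Algebra.smul_def]
    exact (pow_dvd_pow _ hi).mul_left _

end Expansion

theorem TruncPoly.coef_one_ne_zero {k : Type*} [Field k] {N M : ℕ} (hN : 2 ≤ N)
    {φ : TruncPoly k N →ₐ[k] TruncPoly k N} (hφ : Function.Injective φ) {f : ℕ → k}
    (hf : φ (truncT k N) = ∑ i ∈ Icc 1 M, f i • truncT k N ^ i) : f 1 ≠ 0 := by
  intro h
  have hdvd : truncT k N ^ 2 ∣ φ (truncT k N) := by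
    rw [hf]
    exact sq_dvd_sum_smul_pow _ h
  have hzero : φ (truncT k N ^ (N - 1)) = 0 := by
    rw [map_pow]
    refine zero_dvd_iff.1 (dvd_trans ?_ (pow_dvd_pow_of_dvd hdvd (N - 1)))
    rw [← truncT_pow_self (k := k) (N := N), ← pow_mul]
    exact pow_dvd_pow _ (by omega)
  obtain ⟨c, hc⟩ := exists_coeff (k := k) (N := N) (j := N - 1) (by omega)
  have := hc (N - 1)
  rw [hφ (hzero.trans (map_zero φ).symm)] at this
  simp at this

/-- Let `k` be a field of characteristic `p > 0`, `a ∈ k` nonzero, and `n > 2`, or `n = 2` and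
`p = 2`.  Let `A_{a,n}` be `k[T]/(T^{p^n})` with the bialgebra structure in which
`Δ(T̄) = T̄⊗1 + 1⊗T̄ + a • T̄^{p^{n-1}} ⊗ T̄^p` and the counit `ε` sends `T̄` to `0`.  If `φ`
is a bialgebra automorphism of `A_{a,n}` and `φ(T̄) = Σ_{i=1}^{p^n-1} aᵢ T̄^i`, then
`a₁^{p^{n-1}+p-1} = 1`. -/
theorem stmt_15 (k : Type*) [Field k] (p n : ℕ) (hp : p.Prime) (hchar : CharP k p)
    (a : k) (ha : a ≠ 0) (hn : 2 < n ∨ (n = 2 ∧ p = 2))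
    (Δ : TruncPoly k (p ^ n) →ₐ[k] TruncPoly k (p ^ n) ⊗[k] TruncPoly k (p ^ n))
    (ε : TruncPoly k (p ^ n) →ₐ[k] k)
    (hbi : IsBialgebraStructure k (TruncPoly k (p ^ n)) Δ ε)
    (hεT : ε (truncT k (p ^ n)) = 0)
    (hΔT : Δ (truncT k (p ^ n)) =
      truncT k (p ^ n) ⊗ₜ[k] (1 : TruncPoly k (p ^ n)) +
        (1 : TruncPoly k (p ^ n)) ⊗ₜ[k] truncT k (p ^ n) +
        a • ((truncT k (p ^ n) ^ p ^ (n - 1)) ⊗ₜ[k] (truncT k (p ^ n) ^ p)))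
    (φ : TruncPoly k (p ^ n) →ₐ[k] TruncPoly k (p ^ n))
    (hφbij : Function.Bijective φ)
    (hφΔ : ∀ x, Δ (φ x) = (Algebra.TensorProduct.map φ φ) (Δ x))
    (hφε : ∀ x, ε (φ x) = ε x)
    (coef : ℕ → k)
    (hcoef : φ (truncT k (p ^ n)) =
      ∑ i ∈ Finset.Icc 1 (p ^ n - 1), coef i • truncT k (p ^ n) ^ i) :
    coef 1 ^ (p ^ (n - 1) + p - 1) = 1 := by
  have : Fact p.Prime := ⟨hp⟩
  have hp2 := hp.two_le
  set q := p ^ (n - 1) with hq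
  have hN : p ^ n = q * p := by
    rw [hq, ← pow_succ]
    congr 1
    omega
  have hpq : p ≤ q := Nat.le_self_pow (by omega) p
  have hqN : q < p ^ n := by rw [hN]; nlinarith
  have := TruncPoly.nontrivial (k := k) (N := p ^ n) (by omega)
  have := charP_of_injective_algebraMap (algebraMap k (TruncPoly k (p ^ n))).injective p
  obtain ⟨c, hc⟩ := TruncPoly.exists_coeff (k := k) hqN
  obtain ⟨d, hd⟩ := TruncPoly.exists_coeff (k := k) (hpq.trans_lt hqN)
  have h1 : coef 1 ≠ 0 := TruncPoly.coef_one_ne_zero (by omega) hφbij.1 hcoef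
  have hmem : 1 ∈ Icc 1 (p ^ n - 1) := mem_Icc.2 (by omega)
  have hc1 : c 1 = 0 := by simpa [show (0 : ℕ) ≠ q by omega] using hc 0
  have hd1 : d 1 = 0 := by simpa [show (0 : ℕ) ≠ p by omega] using hd 0
  have main := hφΔ (truncT k (p ^ n))
  rw [hΔT] at main
  simp only [map_add, map_smul, Algebra.TensorProduct.map_tmul, map_one, map_pow] at main
  have hdp : d (φ (truncT k (p ^ n)) ^ p) = coef 1 ^ p := by
    have := coeff_sum_pow_prime_pow (p := p) hd (Icc 1 (p ^ n - 1)) coef 1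
    rw [← hcoef] at this
    simpa [Nat.mul_eq_right hp.ne_zero, hmem] using this
  have hcq : c (φ (truncT k (p ^ n)) ^ q) = coef 1 ^ q := by
    have := coeff_sum_pow_prime_pow (p := p) hc (Icc 1 (p ^ n - 1)) coef (n - 1)
    rw [← hcoef, ← hq] at this
    simpa [Nat.mul_eq_right (show q ≠ 0 by omega), hmem] using this
  have hΔφ : Δ (φ (truncT k (p ^ n))) = ∑ i ∈ Icc 1 (p ^ n - 1), coef i •
      (truncT k (p ^ n) ⊗ₜ[k] (1 : TruncPoly k (p ^ n)) +
        (1 : TruncPoly k (p ^ n)) ⊗ₜ[k] truncT k (p ^ n) +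
        a • ((truncT k (p ^ n) ^ q) ⊗ₜ[k] (truncT k (p ^ n) ^ p))) ^ i := by
    rw [hcoef, ← hΔT]
    exact map_sum_smul_pow Δ _ _ _
  have hbinom : ∑ i ∈ Icc 1 (p ^ n - 1),
      coef i * (if i = q + p then (i.choose q : k) else 0) = 0 := by
    rcases hn with hn | ⟨rfl, rfl⟩
    · have hlt : p < q := by
        simpa using Nat.pow_lt_pow_right hp.one_lt (show 1 < n - 1 by omega)
      have hdq : d (φ (truncT k (p ^ n)) ^ q) = 0 := by
        have := coeff_sum_pow_prime_pow (p := p) hd (Icc 1 (p ^ n - 1)) coef (n - 1)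
        rw [← hcoef, ← hq] at this
        rw [this]
        refine sum_eq_zero fun i hi => if_neg ?_
        rw [mem_Icc] at hi
        nlinarith
      have h := congrArg (tensorFunctional d c) main
      rw [hΔφ] at h
      simp only [map_add, map_smul, map_sum, tensorFunctional_tmul, hc1, hd1, hdq, smul_eq_mul,
        tensorFunctional_trinomial_pow_of_lt hd hc a p hlt, zero_mul, mul_zero, add_zero] at h
      refine Eq.trans (sum_congr rfl fun i _ => ?_) h
      rw [add_comm p q]
      split_ifs with hi
      · rw [hi, Nat.choose_symm_add]
      · rfl
    · have h6 : ((Nat.choose 4 2 : ℕ) : k) = 0 :=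
        (CharP.cast_eq_zero_iff k 2 _).2 (by decide)
      refine sum_eq_zero fun i _ => ?_
      split_ifs with hi
      · rw [hi, show (q + 2).choose q = Nat.choose 4 2 by simp [hq], h6, mul_zero]
      · rw [mul_zero]
  have h := congrArg (tensorFunctional c d) main
  rw [hΔφ] at h
  simp only [map_add, map_smul, map_sum, tensorFunctional_tmul, hc1, hd1, hcq, hdp, smul_eq_mul,
    tensorFunctional_trinomial_pow_self hc hd a (show 0 < q by omega), zero_mul, mul_zero,
    zero_add, mul_add, sum_add_distrib, hbinom] at h
  simp only [mul_ite, mul_zero, sum_ite_eq', hmem, if_true] at h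
  have h' : coef 1 ^ (q + p) = coef 1 :=
    mul_left_cancel₀ ha (by rw [pow_add, ← h, mul_comm])
  refine mul_right_cancel₀ h1 ?_
  rw [← pow_succ, one_mul, Nat.sub_add_cancel (by omega), h']
end
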